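/- Let R : [0,∞) → ℝ be continuous and strictly convex on [0, b], let ν* be a Borel probability measure on [0,b], and set σ*² = ∫∫ R(|t − s|) ν*(ds) ν*(dt) and m(t) = ∫_{[0,b]} R(|t − s|) ν*(ds) for t ∈ [0,b]. Suppose m(t) ≥ σ*² for all t ∈ [0,b], with equality for every t in the support of ν*. Then there do not exist points 0 ≤ c₁ < c₂ ≤ b, both in the support of ν*, such that ν*((c₁, c₂)) = 0; consequently, if 0 and b are in the support of ν*, the support of ν* equals [0,b]. -/

import Mathlib

open MeasureTheory Filter Set

/-- The topological support of a Borel measure on `ℝ`. -/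
def measSupport (ν : Measure ℝ) : Set ℝ :=
  {x | ∀ U : Set ℝ, IsOpen U → x ∈ U → 0 < ν U}

theorem measSupport_eq_support (ν : Measure ℝ) : measSupport ν = ν.support := by
  ext x
  rw [(nhds_basis_opens x).mem_measureSupport]
  exact ⟨fun h U hU => h U hU.2 hU.1, fun h U hU hx => h U ⟨hx, hU⟩⟩

theorem integrable_comp_abs_sub {R : ℝ → ℝ} {b : ℝ} (hR : ContinuousOn R (Icc 0 b))
    {ν : Measure ℝ} [IsFiniteMeasure ν] (hν : ∀ᵐ s ∂ν, s ∈ Icc 0 b) {t : ℝ}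
    (ht : t ∈ Icc 0 b) : Integrable (fun s => R |t - s|) ν := by
  have hcont : ContinuousOn (fun s => R |t - s|) (Icc 0 b) := by
    refine hR.comp (by fun_prop) fun s hs => ⟨abs_nonneg _, ?_⟩
    rw [abs_le]
    constructor <;> linarith [hs.1, hs.2, ht.1, ht.2]
  have h := hcont.integrableOn_compact (μ := ν) isCompact_Icc
  rwa [IntegrableOn, Measure.restrict_eq_self_of_ae_mem hν] at h

/-- Outside the gap `(c₁, c₂)`, strict convexity of `R` gives strict midpoint convexity of
`t ↦ R |t - s|`. -/
theorem StrictConvexOn.comp_abs_sub_midpoint_lt {R : ℝ → ℝ} {b c₁ c₂ s : ℝ}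
    (hR : StrictConvexOn ℝ (Icc 0 b) R) (h₀ : 0 ≤ c₁) (hc : c₁ < c₂) (hb : c₂ ≤ b)
    (hs : s ∈ Icc 0 b) (hgap : s ∉ Ioo c₁ c₂) :
    R |(c₁ + c₂) / 2 - s| < (R |c₁ - s| + R |c₂ - s|) / 2 := by
  have key : ∀ x ∈ Icc 0 b, ∀ y ∈ Icc 0 b, x ≠ y → R ((x + y) / 2) < (R x + R y) / 2 := by
    intro x hx y hy hxy
    have h := hR.2 hx hy hxy one_half_pos one_half_pos (add_halves 1)
    simp only [smul_eq_mul] at h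
    rw [show (x + y) / 2 = 1 / 2 * x + 1 / 2 * y by ring]
    linarith
  obtain ⟨hs₀, hsb⟩ := hs
  rcases le_or_gt s c₁ with h | h
  · rw [abs_of_nonneg (by linarith), abs_of_nonneg (by linarith), abs_of_nonneg (by linarith)]
    convert key (c₁ - s) ⟨by linarith, by linarith⟩ (c₂ - s) ⟨by linarith, by linarith⟩
      (by intro h; linarith) using 2
    ring
  · have h' : c₂ ≤ s := not_lt.1 fun h' => hgap ⟨h, h'⟩
    rw [abs_of_nonpos (by linarith), abs_of_nonpos (by linarith), abs_of_nonpos (by linarith)]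
    convert key (-(c₁ - s)) ⟨by linarith, by linarith⟩ (-(c₂ - s)) ⟨by linarith, by linarith⟩
      (by intro h; linarith) using 2
    ring

theorem integral_comp_abs_sub_midpoint_lt {R : ℝ → ℝ} {b c₁ c₂ : ℝ}
    (hRc : ContinuousOn R (Icc 0 b)) (hR : StrictConvexOn ℝ (Icc 0 b) R)
    {ν : Measure ℝ} [IsFiniteMeasure ν] [NeZero ν] (hν : ∀ᵐ s ∂ν, s ∈ Icc 0 b)
    (h₀ : 0 ≤ c₁) (hc : c₁ < c₂) (hb : c₂ ≤ b) (hgap : ν (Ioo c₁ c₂) = 0) :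
    ∫ s, R |(c₁ + c₂) / 2 - s| ∂ν < ((∫ s, R |c₁ - s| ∂ν) + ∫ s, R |c₂ - s| ∂ν) / 2 := by
  have i₁ := integrable_comp_abs_sub hRc hν (t := c₁) ⟨h₀, by linarith⟩
  have i₂ := integrable_comp_abs_sub hRc hν (t := c₂) ⟨by linarith, hb⟩
  have i := integrable_comp_abs_sub hRc hν (t := (c₁ + c₂) / 2) ⟨by linarith, by linarith⟩
  have hlt : ∀ᵐ s ∂ν, R |(c₁ + c₂) / 2 - s| < (R |c₁ - s| + R |c₂ - s|) / 2 := by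
    filter_upwards [hν, measure_eq_zero_iff_ae_notMem.1 hgap] with s hs hs'
    exact hR.comp_abs_sub_midpoint_lt h₀ hc hb hs hs'
  have i' : Integrable (fun s => (R |c₁ - s| + R |c₂ - s|) / 2) ν := (i₁.add i₂).div_const 2
  rw [← integral_add i₁ i₂, ← integral_div, ← sub_pos, ← integral_sub i' i,
    integral_pos_iff_support_of_nonneg_ae (hlt.mono fun s hs => (sub_pos.2 hs).le) (i'.sub i)]
  exact pos_iff_ne_zero.2
    (frequently_ae_iff.1 (hlt.mono fun s hs => (sub_pos.2 hs).ne').frequently)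

/-- A closed set containing `a` and `b` but not all of `[a, b]` has a gap in `[a, b]`. -/
theorem IsClosed.exists_gap {S : Set ℝ} (hS : IsClosed S) {a b x : ℝ} (ha : a ∈ S) (hb : b ∈ S)
    (hx : x ∈ Icc a b) (hxS : x ∉ S) :
    ∃ c₁ ∈ S, ∃ c₂ ∈ S, a ≤ c₁ ∧ c₁ < c₂ ∧ c₂ ≤ b ∧ Disjoint (Ioo c₁ c₂) S := by
  obtain ⟨c₁, ⟨h₁, h₁x⟩, hmax⟩ := (isCompact_Icc.inter_left hS).exists_isGreatest
    ⟨a, ha, left_mem_Icc.2 hx.1⟩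
  obtain ⟨c₂, ⟨h₂, h₂x⟩, hmin⟩ := (isCompact_Icc.inter_left hS).exists_isLeast
    ⟨b, hb, right_mem_Icc.2 hx.2⟩
  have h₁lt : c₁ < x := h₁x.2.lt_of_ne fun h => hxS (h ▸ h₁)
  refine ⟨c₁, h₁, c₂, h₂, h₁x.1, h₁lt.trans_le h₂x.1, h₂x.2, disjoint_left.2 fun y hy hyS => ?_⟩
  rcases le_total y x with h | h
  · exact hy.1.not_ge (hmax ⟨hyS, h₁x.1.trans hy.1.le, h⟩)
  · exact hy.2.not_ge (hmin ⟨hyS, h, hy.2.le.trans h₂x.2⟩)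

/-- Let `R` be continuous and strictly convex on `[0, b]`, and let `ν*` be a
Borel probability measure on `[0, b]`. Set `σ*² = ∫∫ R(|t-s|) ν*(ds) ν*(dt)` and
`m(t) = ∫ R(|t-s|) ν*(ds)`. If `m(t) ≥ σ*²` on `[0, b]` with equality on the support of
`ν*`, then there are no two support points `c₁ < c₂` with `ν*((c₁, c₂)) = 0`;
consequently, if `0` and `b` are in the support, the support equals `[0, b]`. -/
theorem no_gaps_in_support_of_optimal_measure
    (R : ℝ → ℝ) (b : ℝ) (hb : 0 < b)
    (hRcont : ContinuousOn R (Icc 0 b))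
    (hRconv : StrictConvexOn ℝ (Icc 0 b) R)
    (νstar : Measure ℝ) (hprob : IsProbabilityMeasure νstar)
    (hsupp : νstar (Icc 0 b)ᶜ = 0)
    (σsq : ℝ) (hσsq : σsq = ∫ s, ∫ t, R |t - s| ∂νstar ∂νstar)
    (m : ℝ → ℝ) (hm : ∀ t, m t = ∫ s, R |t - s| ∂νstar)
    (hge : ∀ t ∈ Icc (0 : ℝ) b, σsq ≤ m t)
    (heq : ∀ t ∈ measSupport νstar, m t = σsq) :
    (¬ ∃ c₁ c₂ : ℝ, 0 ≤ c₁ ∧ c₁ < c₂ ∧ c₂ ≤ b ∧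
        c₁ ∈ measSupport νstar ∧ c₂ ∈ measSupport νstar ∧
        νstar (Ioo c₁ c₂) = 0) ∧
      ((0 : ℝ) ∈ measSupport νstar → b ∈ measSupport νstar →
        measSupport νstar = Icc 0 b) := by
  have hν : ∀ᵐ s ∂νstar, s ∈ Icc 0 b := hsupp
  have hgap : ¬ ∃ c₁ c₂ : ℝ, 0 ≤ c₁ ∧ c₁ < c₂ ∧ c₂ ≤ b ∧
      c₁ ∈ measSupport νstar ∧ c₂ ∈ measSupport νstar ∧ νstar (Ioo c₁ c₂) = 0 := by
    rintro ⟨c₁, c₂, h₀, hc, hcb, h₁, h₂, h⟩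
    have hlt := integral_comp_abs_sub_midpoint_lt hRcont hRconv hν h₀ hc hcb h
    rw [← hm, ← hm, ← hm, heq c₁ h₁, heq c₂ h₂] at hlt
    linarith [hge ((c₁ + c₂) / 2) ⟨by linarith, by linarith⟩]
  refine ⟨hgap, fun h₀ hb' => Subset.antisymm (fun x hx => ?_) fun x hx => ?_⟩
  · by_contra hxI
    exact (hx _ isClosed_Icc.isOpen_compl hxI).ne' hsupp
  · by_contra hxS
    have hclosed : IsClosed (measSupport νstar) :=
      measSupport_eq_support νstar ▸ Measure.isClosed_support
    obtain ⟨c₁, h₁, c₂, h₂, h0, hc, hcb, hd⟩ := hclosed.exists_gap h₀ hb' hx hxS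
    rw [measSupport_eq_support] at hd
    exact hgap ⟨c₁, c₂, h0, hc, hcb, h₁, h₂,
      measure_mono_null hd.subset_compl_right Measure.measure_compl_support⟩
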